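/- Let x_1 < \dots < x_n be n distinct real nodes and let D be an exact differentiation matrix for these nodes. Then D is nilpotent with D^n = 0 (as an n×n matrix). -/

import Mathlib

open Polynomial Matrix

/-- Evaluation map `Φ : ℝ[X] → ℝⁿ`, `Φ(p) = (p(x₁), …, p(xₙ))`. -/
noncomputable def Phi {n : ℕ} (x : Fin n → ℝ) (p : ℝ[X]) : Fin n → ℝ :=
  fun i => p.eval (x i)

theorem pow_mulVec_Phi {n : ℕ} {x : Fin n → ℝ} {D : Matrix (Fin n) (Fin n) ℝ}
    (hD : ∀ p : ℝ[X], p.degree < n → D.mulVec (Phi x p) = Phi x (derivative p))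
    (k : ℕ) {p : ℝ[X]} (hp : p.degree < n) :
    (D ^ k).mulVec (Phi x p) = Phi x (derivative^[k] p) := by
  induction k generalizing p with
  | zero => simp
  | succ k ih =>
    rw [pow_succ, ← mulVec_mulVec, hD p hp, ih (degree_derivative_le.trans_lt hp),
      Function.iterate_succ_apply]

theorem exists_degree_lt_Phi_eq {n : ℕ} {x : Fin n → ℝ} (hx : Function.Injective x)
    (v : Fin n → ℝ) : ∃ p : ℝ[X], p.degree < n ∧ Phi x p = v := by
  refine ⟨Lagrange.interpolate Finset.univ x v, ?_, funext fun i => ?_⟩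
  · simpa using Lagrange.degree_interpolate_lt v (s := Finset.univ) hx.injOn
  · exact Lagrange.eval_interpolate_at_node v hx.injOn (Finset.mem_univ i)

/-- **Theorem (Nilpotency of the exact differentiation matrix).**
If `D` is an exact differentiation matrix for strictly increasing nodes `x₁ < … < xₙ`,
then `D` is nilpotent with `Dⁿ = 0`. -/
theorem diffMatrix_nilpotent {n : ℕ} (x : Fin n → ℝ) (hx : StrictMono x)
    (D : Matrix (Fin n) (Fin n) ℝ)
    (hD : ∀ p : ℝ[X], p.degree < n → D.mulVec (Phi x p) = Phi x (derivative p)) :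
    D ^ n = 0 := by
  refine Matrix.ext_of_mulVec_single fun i => ?_
  obtain ⟨p, hp, hv⟩ := exists_degree_lt_Phi_eq hx.injective (Pi.single i 1)
  rw [← hv, pow_mulVec_Phi hD n hp, iterate_derivative_eq_zero_of_degree_lt hp, zero_mulVec]
  exact funext fun j => eval_zero
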